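/- (Factorization Continuity Theorem) Let 𝔐 = ((m_1,k_1),…,(m_r,k_r)) be a factorization structure of degree m and let f ∈ F^𝔐 have an irreducible factorization f = α·f_1^{k_1}⋯f_r^{k_r} with f_i ∈ 𝒫^{m_i} irreducible, pairwise non-associated, and ‖f_i‖ = 1. Then there exist constants δ > 0 and η > 0 such that every g ∈ F^𝔐 with ‖f − g‖ < δ admits an irreducible factorization g = β·g_1^{k_1}⋯g_r^{k_r}, with β ∈ ℂ nonzero and g_i ∈ 𝒫^{m_i} irreducible pairwise non-associated, satisfying max_{1≤i≤r} sin(f_i, g_i) ≤ η·‖f − g‖; that is, the irreducible factorization is locally Lipschitz continuous on the factorization manifold. -/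

import Mathlib

open scoped Classical

/-- The Hermitian inner product on coefficients of multivariate polynomials
(conjugate-linear in the first argument). -/
noncomputable def pInner {ℓ : ℕ} (p q : MvPolynomial (Fin ℓ) ℂ) : ℂ :=
  ∑ d ∈ p.support ∪ q.support, (starRingEnd ℂ) (MvPolynomial.coeff d p) * MvPolynomial.coeff d q

/-- The coefficient norm `‖p‖ := √⟪p,p⟫`. -/
noncomputable def pNorm {ℓ : ℕ} (p : MvPolynomial (Fin ℓ) ℂ) : ℝ :=
  Real.sqrt (pInner p p).re

/-- The sine of the principal angle between the spans of two polynomials. -/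
noncomputable def psin {ℓ : ℕ} (p q : MvPolynomial (Fin ℓ) ℂ) : ℝ :=
  if p = 0 then (if q = 0 then 0 else 1)
  else if q = 0 then 1
  else pNorm (((pNorm p : ℂ))⁻¹ • p -
        (pInner q p / ((pNorm q : ℂ) * (pNorm p : ℂ))) • (((pNorm q : ℂ))⁻¹ • q))

/-- The factorization manifold `F^𝔐` of the structure `𝔐 = ((mdeg 1, k 1),…,(mdeg r, k r))`. -/
def FMset {ℓ : ℕ} (r : ℕ) (mdeg : Fin r → Fin ℓ → ℕ) (k : Fin r → ℕ) :
    Set (MvPolynomial (Fin ℓ) ℂ) :=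
  {f | ∃ (β : ℂ) (g : Fin r → MvPolynomial (Fin ℓ) ℂ), β ≠ 0 ∧
        (∀ i, Irreducible (g i)) ∧
        (∀ i t, (g i).degreeOf t = mdeg i t) ∧
        (∀ i j : Fin r, i ≠ j → ¬ Associated (g i) (g j)) ∧
        f = MvPolynomial.C β * ∏ i, g i ^ k i}

namespace MvPolynomial

variable {σ : Type*}

/-- The sum of the absolute values of the coefficients of `p`. -/
noncomputable def coeffSum (p : MvPolynomial σ ℂ) : ℝ := ∑ d ∈ p.support, ‖p.coeff d‖

theorem coeffSum_eq_sum {p : MvPolynomial σ ℂ} {s : Finset (σ →₀ ℕ)} (h : p.support ⊆ s) :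
    coeffSum p = ∑ d ∈ s, ‖p.coeff d‖ :=
  Finset.sum_subset h fun d _ hd => by simp [notMem_support_iff.1 hd]

theorem coeffSum_add_le (p q : MvPolynomial σ ℂ) :
    coeffSum (p + q) ≤ coeffSum p + coeffSum q := by
  rw [coeffSum_eq_sum (support_add (p := p) (q := q)),
    coeffSum_eq_sum (Finset.subset_union_left (s₁ := p.support) (s₂ := q.support)),
    coeffSum_eq_sum (Finset.subset_union_right (s₁ := p.support) (s₂ := q.support)),
    ← Finset.sum_add_distrib]
  exact Finset.sum_le_sum fun d _ => by simpa using norm_add_le _ _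

theorem coeffSum_zero : coeffSum (0 : MvPolynomial σ ℂ) = 0 := by simp [coeffSum]

theorem coeffSum_sum_le {ι : Type*} (s : Finset ι) (f : ι → MvPolynomial σ ℂ) :
    coeffSum (∑ i ∈ s, f i) ≤ ∑ i ∈ s, coeffSum (f i) :=
  Finset.le_sum_of_subadditive _ coeffSum_zero.le coeffSum_add_le _ _

theorem coeffSum_monomial_le (d : σ →₀ ℕ) (c : ℂ) : coeffSum (monomial d c) ≤ ‖c‖ := by
  rw [coeffSum_eq_sum (support_monomial_subset (s := d) (a := c))]
  simp

theorem coeffSum_mul_le (p q : MvPolynomial σ ℂ) :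
    coeffSum (p * q) ≤ coeffSum p * coeffSum q := by
  conv_lhs => rw [p.as_sum, q.as_sum, Finset.sum_mul_sum]
  conv_rhs => rw [coeffSum, coeffSum, Finset.sum_mul_sum]
  refine (coeffSum_sum_le _ _).trans (Finset.sum_le_sum fun d _ => ?_)
  refine (coeffSum_sum_le _ _).trans (Finset.sum_le_sum fun e _ => ?_)
  rw [monomial_mul, ← norm_mul]
  exact coeffSum_monomial_le _ _

theorem norm_coeff_le_coeffSum (d : σ →₀ ℕ) (p : MvPolynomial σ ℂ) :
    ‖p.coeff d‖ ≤ coeffSum p := by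
  by_cases hd : d ∈ p.support
  · exact Finset.single_le_sum (f := fun d => ‖p.coeff d‖) (fun _ _ => norm_nonneg _) hd
  · rw [notMem_support_iff.1 hd, norm_zero]
    exact Finset.sum_nonneg fun _ _ => norm_nonneg _

/-- The `ℓ¹`-norm of the coefficients as a ring norm. -/
noncomputable def coeffSumRingNorm : RingNorm (MvPolynomial σ ℂ) where
  toFun := coeffSum
  map_zero' := coeffSum_zero
  add_le' := coeffSum_add_le
  neg' p := by simp [coeffSum]
  mul_le' := coeffSum_mul_le
  eq_zero_of_map_eq_zero' p hp := by
    ext d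
    have := norm_coeff_le_coeffSum d p
    rw [hp] at this
    simpa using this

/-- The `ℓ¹`-norm of the coefficients makes `MvPolynomial σ ℂ` a normed ring. -/
noncomputable abbrev normedCommRing : NormedCommRing (MvPolynomial σ ℂ) where
  __ := coeffSumRingNorm.toNormedRing
  mul_comm := mul_comm

attribute [local instance] normedCommRing

/-- The uniformity of the `ℓ¹`-norm, to be preferred to that of coefficientwise convergence. -/
noncomputable abbrev normUniformSpace : UniformSpace (MvPolynomial σ ℂ) :=
  normedCommRing.toPseudoMetricSpace.toUniformSpace

attribute [local instance] normUniformSpace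

/-- The `ℓ¹`-norm of the coefficients makes `MvPolynomial σ ℂ` a normed algebra. -/
noncomputable abbrev normedAlgebra : NormedAlgebra ℂ (MvPolynomial σ ℂ) where
  norm_smul_le c p := by
    rw [smul_eq_C_mul]
    refine (norm_mul_le _ _).trans ?_
    gcongr
    exact coeffSum_monomial_le 0 c

attribute [local instance] normedAlgebra

/-- The continuous linear functional extracting the coefficient of the monomial `d`. -/
noncomputable def coeffCLM (d : σ →₀ ℕ) : MvPolynomial σ ℂ →L[ℂ] ℂ :=
  (lcoeff ℂ d).mkContinuous 1 fun p => by
    rw [one_mul]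
    exact norm_coeff_le_coeffSum d p

end MvPolynomial

section HermitianNorm

open MvPolynomial

variable {ℓ : ℕ}

/-- The coefficients in a finite set `s` of monomials, as a vector of a Euclidean space. -/
noncomputable def coeffVec (s : Finset (Fin ℓ →₀ ℕ)) :
    MvPolynomial (Fin ℓ) ℂ →ₗ[ℂ] EuclideanSpace ℂ s where
  toFun p := WithLp.toLp 2 fun d => p.coeff d
  map_add' p q := by ext; simp
  map_smul' c p := by ext; simp

theorem pInner_eq_inner {s : Finset (Fin ℓ →₀ ℕ)} {p q : MvPolynomial (Fin ℓ) ℂ}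
    (hp : p.support ⊆ s) (hq : q.support ⊆ s) :
    pInner p q = inner ℂ (coeffVec s p) (coeffVec s q) := by
  rw [pInner, Finset.sum_subset (Finset.union_subset hp hq) fun d _ hd => by
    simp only [Finset.mem_union, not_or, notMem_support_iff] at hd
    simp [hd.1]]
  rw [PiLp.inner_apply, ← Finset.sum_coe_sort s]
  exact Finset.sum_congr rfl fun d _ => by simp [coeffVec, mul_comm]

theorem pNorm_eq_norm {s : Finset (Fin ℓ →₀ ℕ)} {p : MvPolynomial (Fin ℓ) ℂ}
    (hp : p.support ⊆ s) : pNorm p = ‖coeffVec s p‖ := by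
  rw [pNorm, pInner_eq_inner hp hp, norm_eq_sqrt_re_inner (𝕜 := ℂ)]
  rfl

theorem pNorm_eq_sqrt_sum {s : Finset (Fin ℓ →₀ ℕ)} {p : MvPolynomial (Fin ℓ) ℂ}
    (hp : p.support ⊆ s) : pNorm p = √(∑ d ∈ s, ‖p.coeff d‖ ^ 2) := by
  rw [pNorm_eq_norm hp, EuclideanSpace.norm_eq, ← Finset.sum_coe_sort s]
  rfl

theorem pNorm_le_coeffSum (p : MvPolynomial (Fin ℓ) ℂ) : pNorm p ≤ coeffSum p := by
  rw [pNorm_eq_sqrt_sum subset_rfl]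
  have h0 : 0 ≤ coeffSum p := Finset.sum_nonneg fun _ _ => norm_nonneg _
  refine Real.sqrt_le_iff.2 ⟨h0, Finset.sum_sq_le_sq_sum_of_nonneg fun _ _ => norm_nonneg _⟩

theorem coeffSum_le_sqrt_card_mul_pNorm {s : Finset (Fin ℓ →₀ ℕ)} {p : MvPolynomial (Fin ℓ) ℂ}
    (hp : p.support ⊆ s) : coeffSum p ≤ √s.card * pNorm p := by
  rw [pNorm_eq_sqrt_sum hp, ← Real.sqrt_mul (by positivity), coeffSum_eq_sum hp]
  exact Real.le_sqrt_of_sq_le sq_sum_le_card_mul_sum_sq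

theorem norm_sub_inner_div_smul_le {E : Type*} [NormedAddCommGroup E] [InnerProductSpace ℂ E]
    (x y : E) : ‖x - (inner ℂ y x / ((‖y‖ : ℂ) * (‖y‖ : ℂ))) • y‖ ≤ ‖x - y‖ := by
  rcases eq_or_ne y 0 with rfl | hy
  · simp
  set t := inner ℂ y x / ((‖y‖ : ℂ) * (‖y‖ : ℂ)) with ht
  have hort : inner ℂ (x - t • y) ((t - 1) • y) = 0 := by
    rw [inner_smul_right, ← inner_conj_symm, inner_sub_right, inner_smul_right,
      inner_self_eq_norm_sq_to_K]
    have : (‖y‖ : ℂ) ≠ 0 := by simpa using hy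
    rw [ht, RCLike.ofReal_eq_complex_ofReal]
    field_simp
    simp
  have hdec : x - y = (x - t • y) + (t - 1) • y := by rw [sub_smul, one_smul]; abel
  have := norm_add_sq_eq_norm_sq_add_norm_sq_of_inner_eq_zero _ _ hort
  rw [← hdec] at this
  nlinarith [norm_nonneg (x - y), norm_nonneg (x - t • y), norm_nonneg ((t - 1) • y)]

theorem psin_le_pNorm_sub {p q : MvPolynomial (Fin ℓ) ℂ} (hp : pNorm p = 1) (hp0 : p ≠ 0)
    (hq : q ≠ 0) : psin p q ≤ pNorm (p - q) := by
  have hl := Finset.subset_union_left (s₁ := p.support) (s₂ := q.support)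
  have hr := Finset.subset_union_right (s₁ := p.support) (s₂ := q.support)
  have hs : ∀ c : ℂ, (p - c • q).support ⊆ p.support ∪ q.support := fun c =>
    (support_sub _ p (c • q)).trans (Finset.union_subset_union subset_rfl support_smul)
  have h1 := hs 1
  rw [one_smul] at h1
  rw [psin, if_neg hp0, if_neg hq, hp, Complex.ofReal_one, inv_one, one_smul, mul_one, smul_smul,
    pNorm_eq_norm (hs _), pNorm_eq_norm h1, pInner_eq_inner hr hl, pNorm_eq_norm hr,
    ← div_eq_mul_inv, div_div, map_sub, map_sub, map_smul]
  exact norm_sub_inner_div_smul_le _ _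

end HermitianNorm

open UniqueFactorizationMonoid in
theorem card_normalizedFactors_prod_pow {R ι : Type*} [CommRing R] [IsDomain R]
    [NormalizationMonoid R] [UniqueFactorizationMonoid R] (s : Finset ι) (g : ι → R) (k : ι → ℕ)
    (hg : ∀ i ∈ s, g i ≠ 0) :
    (normalizedFactors (∏ i ∈ s, g i ^ k i)).card
      = ∑ i ∈ s, k i * (normalizedFactors (g i)).card := by
  induction s using Finset.cons_induction with
  | empty => simp
  | cons a s ha ih =>
    have hs : ∀ i ∈ s, g i ≠ 0 := fun i hi => hg i (by simp [hi])
    rw [Finset.prod_cons, Finset.sum_cons, normalizedFactors_mul (pow_ne_zero _ (hg a (by simp)))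
      (Finset.prod_ne_zero_iff.2 fun i hi => pow_ne_zero _ (hs i hi)), Multiset.card_add, ih hs,
      normalizedFactors_pow, Multiset.card_nsmul]

theorem Prime.exists_dvd_of_dvd_prod_pow {R ι : Type*} [CommRing R] {s : Finset ι} {p : R}
    (hp : Prime p) {g : ι → R} {k : ι → ℕ} (h : p ∣ ∏ i ∈ s, g i ^ k i) : ∃ i ∈ s, p ∣ g i := by
  obtain ⟨i, hi, h⟩ := (hp.dvd_finsetProd_iff _).1 h
  exact ⟨i, hi, hp.dvd_of_dvd_pow h⟩

/-- If `∏ g i ^ k i` is associated with `∏ f i ^ k i`, where the `f i` are irreducible and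
pairwise non-associated and the `g i` are non-units, then the `g i` are, up to units and up to a
permutation preserving the exponents, the `f i`. -/
theorem exists_perm_associated_of_prod_pow {R ι : Type*} [CommRing R] [IsDomain R]
    [UniqueFactorizationMonoid R] [Fintype ι] {f g : ι → R} {k : ι → ℕ} (hk : ∀ i, 1 ≤ k i)
    (hf : ∀ i, Irreducible (f i)) (hff : ∀ i j, i ≠ j → ¬ Associated (f i) (f j))
    (hg : ∀ i, ¬ IsUnit (g i)) (h : Associated (∏ i, g i ^ k i) (∏ i, f i ^ k i)) :
    ∃ σ : Equiv.Perm ι, ∀ i, Associated (g (σ i)) (f i) ∧ k (σ i) = k i := by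
  classical
  let _ := UniqueFactorizationMonoid.strongNormalizationMonoid (α := R)
  have hP : ∏ i, f i ^ k i ≠ 0 := Finset.prod_ne_zero_iff.2 fun i _ => pow_ne_zero _ (hf i).ne_zero
  have hQ : ∏ i, g i ^ k i ≠ 0 := h.ne_zero_iff.2 hP
  have hg0 : ∀ i, g i ≠ 0 := fun i hi => hQ <| Finset.prod_eq_zero (Finset.mem_univ i) <| by
    rw [hi, zero_pow (by have := hk i; lia)]
  have hpos : ∀ i, 1 ≤ (UniqueFactorizationMonoid.normalizedFactors (g i)).card := fun i => by
    rw [Nat.one_le_iff_ne_zero, Ne, Multiset.card_eq_zero,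
      UniqueFactorizationMonoid.normalizedFactors_eq_zero_iff (hg0 i)]
    exact hg i
  have hsum : ∑ i, k i * 1
      = ∑ i, k i * (UniqueFactorizationMonoid.normalizedFactors (g i)).card := by
    rw [← card_normalizedFactors_prod_pow _ _ _ fun i _ => hg0 i, h.normalizedFactors_eq,
      card_normalizedFactors_prod_pow _ _ _ fun i _ => (hf i).ne_zero]
    simp [UniqueFactorizationMonoid.normalizedFactors_irreducible (hf _)]
  have hone : ∀ i, (UniqueFactorizationMonoid.normalizedFactors (g i)).card = 1 := fun i => by
    have := (Finset.sum_eq_sum_iff_of_le fun i _ => Nat.mul_le_mul_left (k i) (hpos i)).1 hsum i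
      (Finset.mem_univ i)
    exact (Nat.eq_of_mul_eq_mul_left (hk i) this).symm
  have hgp : ∀ i, Prime (g i) := fun i => by
    obtain ⟨p, hp⟩ := Multiset.card_eq_one.1 (hone i)
    have h1 := UniqueFactorizationMonoid.prod_normalizedFactors (hg0 i)
    rw [hp, Multiset.prod_singleton] at h1
    exact h1.prime (UniqueFactorizationMonoid.prime_of_normalized_factor p
      (hp ▸ Multiset.mem_singleton_self p))
  have hex : ∀ j, ∃ i, Associated (g i) (f j) := fun j => by
    have : f j ∣ ∏ i, g i ^ k i := h.dvd_iff_dvd_right.2 <|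
      (dvd_pow_self _ (by have := hk j; lia)).trans
        (Finset.dvd_prod_of_mem (fun i => f i ^ k i) (Finset.mem_univ j))
    obtain ⟨i, -, hi⟩ := (hf j).prime.exists_dvd_of_dvd_prod_pow this
    exact ⟨i, ((hf j).prime.associated_of_dvd (hgp i) hi).symm⟩
  choose τ hτ using hex
  have hinj : Function.Injective τ := fun i j hij => by
    by_contra hne
    exact hff i j hne ((hτ i).symm.trans (hij ▸ hτ j))
  let σ : Equiv.Perm ι := Equiv.ofBijective τ (Finite.injective_iff_bijective.1 hinj)
  have hσ : ∀ i, Associated (g (σ i)) (f i) := hτ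
  have hassoc : Associated (∏ i, f i ^ k i) (∏ i, f i ^ k (σ i)) := by
    refine h.symm.trans ?_
    rw [← Equiv.prod_comp σ]
    exact Associated.prod _ _ _ fun i _ => (hσ i).pow_pow
  have hle : ∀ j ∈ Finset.univ, k j ≤ k (σ j) := fun j _ => by
    have hd : f j ^ k j ∣ ∏ i, f i ^ k (σ i) :=
      (Finset.dvd_prod_of_mem (fun i => f i ^ k i) (Finset.mem_univ j)).trans hassoc.dvd
    rw [← Finset.mul_prod_erase _ _ (Finset.mem_univ j)] at hd
    have := (hf j).prime.pow_dvd_of_dvd_mul_right _ (fun hd' => by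
      obtain ⟨i, hi, hij⟩ := (hf j).prime.exists_dvd_of_dvd_prod_pow hd'
      exact hff j i (Finset.ne_of_mem_erase hi).symm
        ((hf j).prime.associated_of_dvd (hf i).prime hij)) hd
    exact (pow_dvd_pow_iff (hf j).ne_zero (hf j).not_isUnit).1 this
  have hkeq := (Finset.sum_eq_sum_iff_of_le hle).1 (Equiv.sum_comp σ k).symm
  exact ⟨σ, fun i => ⟨hσ i, (hkeq i (Finset.mem_univ i)).symm⟩⟩

section Factorization

open MvPolynomial Filter Topology

attribute [local instance] normedCommRing normUniformSpace normedAlgebra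

/-- A non-zero scalar factor of a convergent product converges along with the other factor. -/
theorem exists_tendsto_of_tendsto_smul {σ ι : Type*} {l : Filter ι} [l.NeBot] {b : ι → ℂ}
    {P : ι → MvPolynomial σ ℂ} {p q : MvPolynomial σ ℂ} (hP : Tendsto P l (𝓝 p)) (hp : p ≠ 0)
    (hq : Tendsto (fun n => b n • P n) l (𝓝 q)) :
    ∃ c : ℂ, Tendsto b l (𝓝 c) ∧ q = c • p := by
  obtain ⟨d, hd⟩ := ne_zero_iff.1 hp
  have hPd : Tendsto (fun n => (P n).coeff d) l (𝓝 (p.coeff d)) :=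
    ((coeffCLM d).continuous.tendsto p).comp hP
  have hqd : Tendsto (fun n => (b n • P n).coeff d) l (𝓝 (q.coeff d)) :=
    ((coeffCLM d).continuous.tendsto q).comp hq
  have hb : Tendsto b l (𝓝 (q.coeff d / p.coeff d)) := by
    refine (hqd.div hPd hd).congr' ?_
    filter_upwards [hPd.eventually_ne hd] with n hn
    simp [hn]
  exact ⟨_, hb, tendsto_nhds_unique hq (hb.smul hP)⟩

variable {ℓ : ℕ}

/-- The exponents bounded by `m`. -/
noncomputable def boxExponents (m : Fin ℓ → ℕ) : Finset (Fin ℓ →₀ ℕ) :=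
  Finset.Iic (Finsupp.equivFunOnFinite.symm m)

/-- The space of polynomials whose degree in the `t`-th variable is at most `m t`. -/
noncomputable abbrev box (m : Fin ℓ → ℕ) : Submodule ℂ (MvPolynomial (Fin ℓ) ℂ) :=
  restrictSupport ℂ (boxExponents m : Set (Fin ℓ →₀ ℕ))

theorem mem_box_iff {m : Fin ℓ → ℕ} {p : MvPolynomial (Fin ℓ) ℂ} :
    p ∈ box m ↔ ∀ t, p.degreeOf t ≤ m t := by
  rw [mem_restrictSupport_iff, Finset.coe_subset]
  simp only [degreeOf_le_iff, Finset.subset_iff, boxExponents, Finset.mem_Iic, Finsupp.le_def,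
    Finsupp.equivFunOnFinite_symm_apply_apply]
  exact ⟨fun h t d hd => h hd t, fun h d hd t => h t d hd⟩

instance (m : Fin ℓ → ℕ) : FiniteDimensional ℂ (box m) :=
  Module.Finite.of_basis (basisRestrictSupport ℂ (boxExponents m : Set (Fin ℓ →₀ ℕ)))

theorem degreeOf_eq_of_associated {p q : MvPolynomial (Fin ℓ) ℂ} (h : Associated p q)
    (t : Fin ℓ) : p.degreeOf t = q.degreeOf t := by
  obtain ⟨u, rfl⟩ := h
  obtain ⟨c, hc, hu⟩ := isUnit_iff_eq_C_of_isReduced.1 u.isUnit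
  rw [hu, mul_comm, degreeOf_C_mul _ _ (mem_nonZeroDivisors_of_ne_zero hc.ne_zero)]

theorem exists_smul_eq_of_associated {p q : MvPolynomial (Fin ℓ) ℂ} (h : Associated p q) :
    ∃ c : ℂ, c ≠ 0 ∧ q = c • p := by
  obtain ⟨u, rfl⟩ := h
  obtain ⟨c, hc, hu⟩ := isUnit_iff_eq_C_of_isReduced.1 u.isUnit
  exact ⟨c, hc.ne_zero, by rw [hu, mul_comm, smul_eq_C_mul]⟩

theorem associated_smul {c : ℂ} (hc : c ≠ 0) (p : MvPolynomial (Fin ℓ) ℂ) :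
    Associated p (c • p) := by
  rw [smul_eq_C_mul]
  exact associated_unit_mul_right p _ ((isUnit_iff_ne_zero.2 hc).map C)

theorem exists_smul_eq_of_dvd_of_degreeOf_le {p q : MvPolynomial (Fin ℓ) ℂ} (h : p ∣ q)
    (hdeg : ∀ t, q.degreeOf t ≤ p.degreeOf t) : ∃ c : ℂ, q = c • p := by
  obtain ⟨s, rfl⟩ := h
  by_cases hs : s = 0
  · exact ⟨0, by simp [hs]⟩
  by_cases hp : p = 0
  · exact ⟨0, by simp [hp]⟩
  have hs0 : s.totalDegree = 0 := by
    refine (totalDegree_eq_zero_iff _ s).2 fun d hd t => ?_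
    have := hdeg t
    rw [degreeOf_mul_eq hp hs] at this
    have := degreeOf_le_iff.1 (show s.degreeOf t ≤ 0 by lia) d hd
    lia
  exact ⟨_, by rw [smul_eq_C_mul, mul_comm, ← totalDegree_eq_zero_iff_eq_C.1 hs0]⟩

theorem degreeOf_prod_pow {ι : Type*} (s : Finset ι) {g : ι → MvPolynomial (Fin ℓ) ℂ}
    (hg : ∀ i, g i ≠ 0) (k : ι → ℕ) (t : Fin ℓ) :
    (∏ i ∈ s, g i ^ k i).degreeOf t = ∑ i ∈ s, k i * (g i).degreeOf t := by
  rw [degreeOf_prod_eq _ _ fun i _ => pow_ne_zero _ (hg i)]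
  exact Finset.sum_congr rfl fun i _ => degreeOf_pow_eq _ _ _ (hg i)

/-- Vanishing of the differential of `(b, h) ↦ b • ∏ h i ^ k i` at a tuple of pairwise
non-associated irreducibles forces divisibility of the increments. -/
theorem dvd_of_prod_pow_differential_eq_zero {R ι : Type*} [CommRing R] [IsDomain R]
    [UniqueFactorizationMonoid R] [Algebra ℂ R] [Fintype ι] [DecidableEq ι] {f h : ι → R}
    {k : ι → ℕ} (hk : ∀ i, 1 ≤ k i) (hf : ∀ i, Irreducible (f i))
    (hff : ∀ i j, i ≠ j → ¬ Associated (f i) (f j)) {a b : ℂ} (ha : a ≠ 0)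
    (h0 : a • ∑ i, (∏ j ∈ Finset.univ.erase i, f j ^ k j) * (k i • f i ^ (k i - 1) * h i)
      + b • ∏ i, f i ^ k i = 0) (i : ι) : f i ∣ h i := by
  have hdvd : f i ^ k i ∣ a • ((∏ j ∈ Finset.univ.erase i, f j ^ k j) *
      (k i • f i ^ (k i - 1) * h i)) := by
    have hrest : f i ^ k i ∣ ∑ j ∈ Finset.univ.erase i,
        (∏ j' ∈ Finset.univ.erase j, f j' ^ k j') * (k j • f j ^ (k j - 1) * h j) :=
      Finset.dvd_sum fun j hj => Dvd.dvd.mul_right (Finset.dvd_prod_of_mem (fun j => f j ^ k j)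
        (Finset.mem_erase.2 ⟨(Finset.ne_of_mem_erase hj).symm, Finset.mem_univ i⟩)) _
    rw [← Finset.add_sum_erase _ _ (Finset.mem_univ i), smul_add, add_assoc] at h0
    rw [eq_neg_of_add_eq_zero_left h0, dvd_neg]
    exact dvd_add (dvd_smul_of_dvd _ hrest) (dvd_smul_of_dvd _
      (Finset.dvd_prod_of_mem (fun j => f j ^ k j) (Finset.mem_univ i)))
  have hka : a * k i ≠ 0 := mul_ne_zero ha (by have := hk i; norm_cast; lia)
  have hfac : a • ((∏ j ∈ Finset.univ.erase i, f j ^ k j) * (k i • f i ^ (k i - 1) * h i))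
      = f i ^ (k i - 1) * ((a * k i) • ((∏ j ∈ Finset.univ.erase i, f j ^ k j) * h i)) := by
    rw [nsmul_eq_mul]
    simp only [Algebra.smul_def, map_mul, map_natCast]
    ring
  rw [hfac, ← pow_sub_one_mul (by have := hk i; lia),
    mul_dvd_mul_iff_left (pow_ne_zero _ (hf i).ne_zero)] at hdvd
  have hdvd' := dvd_smul_of_dvd (a * k i)⁻¹ hdvd
  rw [smul_smul, inv_mul_cancel₀ hka, one_smul] at hdvd'
  refine ((hf i).prime.dvd_or_dvd hdvd').resolve_left fun hd => ?_
  obtain ⟨j, hj, hij⟩ := (hf i).prime.exists_dvd_of_dvd_prod_pow hd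
  exact hff i j (Finset.ne_of_mem_erase hj).symm
    ((hf i).prime.associated_of_dvd (hf j).prime hij)

/-- The map `(β, g) ↦ β • ∏ g i ^ k i`, together with the coefficients of `g i` at `d i`. -/
noncomputable def factorizationMap {r : ℕ} (mdeg : Fin r → Fin ℓ → ℕ) (k : Fin r → ℕ)
    (d : Fin r → Fin ℓ →₀ ℕ) (x : ℂ × ((i : Fin r) → box (mdeg i))) :
    MvPolynomial (Fin ℓ) ℂ × (Fin r → ℂ) :=
  (x.1 • ∏ i, (x.2 i : MvPolynomial (Fin ℓ) ℂ) ^ k i,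
    fun i => (x.2 i : MvPolynomial (Fin ℓ) ℂ).coeff (d i))

/-- Near a tuple of pairwise non-associated irreducible polynomials, `factorizationMap` is
bounded below. -/
theorem exists_eventually_norm_sub_le_factorizationMap {r : ℕ} {mdeg : Fin r → Fin ℓ → ℕ}
    {k : Fin r → ℕ} (hk : ∀ i, 1 ≤ k i) {d : Fin r → Fin ℓ →₀ ℕ} {a : ℂ} (ha : a ≠ 0)
    {f : (i : Fin r) → box (mdeg i)} (hf : ∀ i, Irreducible (f i : MvPolynomial (Fin ℓ) ℂ))
    (hff : ∀ i j, i ≠ j →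
      ¬ Associated (f i : MvPolynomial (Fin ℓ) ℂ) (f j : MvPolynomial (Fin ℓ) ℂ))
    (hdeg : ∀ i t, (f i : MvPolynomial (Fin ℓ) ℂ).degreeOf t = mdeg i t)
    (hd : ∀ i, (f i : MvPolynomial (Fin ℓ) ℂ).coeff (d i) ≠ 0) :
    ∃ K : ℝ, ∀ᶠ x in 𝓝 (a, f),
      ‖x - (a, f)‖ ≤ K * ‖factorizationMap mdeg k d x - factorizationMap mdeg k d (a, f)‖ := by
  let π (i : Fin r) : (ℂ × ((i : Fin r) → box (mdeg i))) →L[ℂ] MvPolynomial (Fin ℓ) ℂ :=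
    (box (mdeg i)).subtypeL ∘L ContinuousLinearMap.proj i ∘L ContinuousLinearMap.snd ℂ ℂ _
  have hprod : HasFDerivAt (fun x => ∏ i, π i x ^ k i) _ (a, f) :=
    HasFDerivAt.finsetProd (u := Finset.univ) fun i _ => ((π i).hasFDerivAt (x := (a, f))).pow (k i)
  have hfst : HasFDerivAt (fun x => ContinuousLinearMap.fst ℂ ℂ ((i : Fin r) → box (mdeg i)) x) _
      (a, f) := (ContinuousLinearMap.fst ℂ ℂ ((i : Fin r) → box (mdeg i))).hasFDerivAt
  have hcoeff : HasFDerivAt (fun x => ContinuousLinearMap.pi (fun i => coeffCLM (d i) ∘L π i) x) _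
      (a, f) := (ContinuousLinearMap.pi (fun i => coeffCLM (d i) ∘L π i)).hasFDerivAt
  obtain ⟨D, hder, hD⟩ : ∃ D, HasFDerivAt (factorizationMap mdeg k d) D (a, f) ∧ ∀ x, D x =
      (a • ∑ i, (∏ j ∈ Finset.univ.erase i, (f j : MvPolynomial (Fin ℓ) ℂ) ^ k j) *
        (k i • (f i : MvPolynomial (Fin ℓ) ℂ) ^ (k i - 1) * x.2 i) +
        x.1 • ∏ i, (f i : MvPolynomial (Fin ℓ) ℂ) ^ k i,
        fun i => (x.2 i : MvPolynomial (Fin ℓ) ℂ).coeff (d i)) := by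
    refine ⟨_, (hfst.smul hprod).prodMk hcoeff, fun x => ?_⟩
    simp only [ContinuousLinearMap.prod_apply, add_apply, smul_apply, sum_apply,
      smul_eq_mul]
    rfl
  have hker : LinearMap.ker D.toLinearMap = ⊥ := by
    refine LinearMap.ker_eq_bot'.2 fun x hx => ?_
    obtain ⟨h1, h2⟩ := Prod.ext_iff.1 ((hD x).symm.trans hx)
    have hx2 : ∀ i, x.2 i = 0 := fun i => by
      obtain ⟨c, hc⟩ := exists_smul_eq_of_dvd_of_degreeOf_le
        (dvd_of_prod_pow_differential_eq_zero (h := fun i => (x.2 i : MvPolynomial (Fin ℓ) ℂ))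
          hk hf hff ha h1 i)
        fun t => (hdeg i t).symm ▸ mem_box_iff.1 (x.2 i).2 t
      have hci : (x.2 i : MvPolynomial (Fin ℓ) ℂ).coeff (d i) = 0 := congrFun h2 i
      rw [hc, coeff_smul, smul_eq_mul] at hci
      have hc0 := (mul_eq_zero.1 hci).resolve_right (hd i)
      exact Subtype.ext (by rw [hc, hc0, zero_smul]; rfl)
    have hx1 : x.1 = 0 := by
      simp only [hx2, ZeroMemClass.coe_zero, mul_zero, Finset.sum_const_zero, smul_zero,
        zero_add, Prod.fst_zero] at h1
      exact (smul_eq_zero.1 h1).resolve_right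
        (Finset.prod_ne_zero_iff.2 fun i _ => pow_ne_zero _ (hf i).ne_zero)
    exact Prod.ext hx1 (funext hx2)
  obtain ⟨K, -, hK⟩ := D.toLinearMap.exists_antilipschitzWith hker
  have hind : Topology.IsInducing D :=
    (AntilipschitzWith.isUniformInducing (f := D) hK D.uniformContinuous).isInducing
  obtain ⟨K', hK'⟩ := (hder.isTheta_sub hind).isBigO_symm.bound
  exact ⟨K', hK'⟩

/-- `β * ∏ gs i ^ k i` is an irreducible factorization of `g` with factor degrees `mdeg`. -/
structure IsFactorization {r : ℕ} (mdeg : Fin r → Fin ℓ → ℕ) (k : Fin r → ℕ)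
    (g : MvPolynomial (Fin ℓ) ℂ) (β : ℂ) (gs : Fin r → MvPolynomial (Fin ℓ) ℂ) : Prop where
  ne_zero : β ≠ 0
  irreducible : ∀ i, Irreducible (gs i)
  degreeOf_eq : ∀ i t, (gs i).degreeOf t = mdeg i t
  not_associated : ∀ i j : Fin r, i ≠ j → ¬ Associated (gs i) (gs j)
  eq_mul_prod : g = C β * ∏ i, gs i ^ k i

theorem IsFactorization.smul {r : ℕ} {mdeg : Fin r → Fin ℓ → ℕ} {k : Fin r → ℕ}
    {g : MvPolynomial (Fin ℓ) ℂ} {β : ℂ} {gs : Fin r → MvPolynomial (Fin ℓ) ℂ}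
    (h : IsFactorization mdeg k g β gs) {s : Fin r → ℂ} (hs : ∀ i, s i ≠ 0) :
    IsFactorization mdeg k g (β * ∏ i, ((s i) ^ k i)⁻¹) fun i => s i • gs i where
  ne_zero := mul_ne_zero h.ne_zero <| Finset.prod_ne_zero_iff.2 fun i _ =>
    inv_ne_zero (pow_ne_zero _ (hs i))
  irreducible i := (associated_smul (hs i) _).irreducible (h.irreducible i)
  degreeOf_eq i t := by
    rw [← degreeOf_eq_of_associated (associated_smul (hs i) _), h.degreeOf_eq]
  not_associated i j hij hass := h.not_associated i j hij <|
    ((associated_smul (hs i) _).trans hass).trans (associated_smul (hs j) _).symm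
  eq_mul_prod := by
    have hs' : (∏ i, s i ^ k i) ≠ 0 := Finset.prod_ne_zero_iff.2 fun i _ => pow_ne_zero _ (hs i)
    rw [h.eq_mul_prod, Finset.prod_inv_distrib]
    simp only [smul_eq_C_mul, mul_pow, Finset.prod_mul_distrib, ← map_pow, ← map_prod]
    rw [← mul_assoc, ← map_mul, mul_assoc β, inv_mul_cancel₀ hs', mul_one]

theorem IsFactorization.perm {r : ℕ} {mdeg : Fin r → Fin ℓ → ℕ} {k : Fin r → ℕ}
    {g : MvPolynomial (Fin ℓ) ℂ} {β : ℂ} {gs : Fin r → MvPolynomial (Fin ℓ) ℂ}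
    (h : IsFactorization mdeg k g β gs) {σ : Equiv.Perm (Fin r)} (hm : ∀ i, mdeg (σ i) = mdeg i)
    (hk : ∀ i, k (σ i) = k i) : IsFactorization mdeg k g β fun i => gs (σ i) where
  ne_zero := h.ne_zero
  irreducible i := h.irreducible _
  degreeOf_eq i t := by rw [h.degreeOf_eq, hm]
  not_associated i j hij := h.not_associated _ _ fun h => hij (σ.injective h)
  eq_mul_prod := by
    rw [h.eq_mul_prod, ← Equiv.prod_comp σ]
    simp only [hk]

/-- Every factorization can be normalized so that its factors have `ℓ¹`-norm one. -/
theorem IsFactorization.exists_norm_eq_one {r : ℕ} {mdeg : Fin r → Fin ℓ → ℕ} {k : Fin r → ℕ}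
    {g : MvPolynomial (Fin ℓ) ℂ} {β : ℂ} {gs : Fin r → MvPolynomial (Fin ℓ) ℂ}
    (h : IsFactorization mdeg k g β gs) :
    ∃ β' gs', IsFactorization mdeg k g β' gs' ∧ ∀ i, ‖gs' i‖ = 1 := by
  have h0 : ∀ i, (‖gs i‖ : ℂ)⁻¹ ≠ 0 := fun i => by simpa using (h.irreducible i).ne_zero
  refine ⟨_, _, h.smul h0, fun i => ?_⟩
  have := (h.irreducible i).ne_zero
  simp [norm_smul, this]

theorem IsFactorization.mem_box {r : ℕ} {m : Fin ℓ → ℕ} {mdeg : Fin r → Fin ℓ → ℕ}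
    {k : Fin r → ℕ} {g : MvPolynomial (Fin ℓ) ℂ} {β : ℂ} {gs : Fin r → MvPolynomial (Fin ℓ) ℂ}
    (h : IsFactorization mdeg k g β gs) (hsum : ∀ t, ∑ i, k i * mdeg i t = m t) : g ∈ box m := by
  refine mem_box_iff.2 fun t => ?_
  rw [h.eq_mul_prod, degreeOf_C_mul _ _ (mem_nonZeroDivisors_of_ne_zero h.ne_zero),
    degreeOf_prod_pow _ (fun i => (h.irreducible i).ne_zero), ← hsum t]
  simp [h.degreeOf_eq]

/-- A factorization `F = b • ∏ y i ^ k i` with the degrees of `y i` bounded by those of an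
irreducible factorization of `F` is a rearrangement of the latter. -/
theorem IsFactorization.exists_perm {r : ℕ} {mdeg : Fin r → Fin ℓ → ℕ} {k : Fin r → ℕ}
    {F : MvPolynomial (Fin ℓ) ℂ} {α : ℂ} {fs : Fin r → MvPolynomial (Fin ℓ) ℂ}
    (h : IsFactorization mdeg k F α fs) (hmdeg : ∀ i, mdeg i ≠ 0) (hk : ∀ i, 1 ≤ k i) {b : ℂ}
    {y : Fin r → MvPolynomial (Fin ℓ) ℂ} (hy : ∀ i, y i ∈ box (mdeg i)) (hy0 : ∀ i, y i ≠ 0)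
    (hF : F = b • ∏ i, y i ^ k i) :
    ∃ σ : Equiv.Perm (Fin r), (∀ i, mdeg (σ i) = mdeg i) ∧ (∀ i, k (σ i) = k i) ∧
      ∀ i, Associated (y (σ i)) (fs i) := by
  have hf0 : ∀ i, fs i ≠ 0 := fun i => (h.irreducible i).ne_zero
  have hF0 : F ≠ 0 := by
    rw [h.eq_mul_prod]
    exact mul_ne_zero (C_ne_zero.2 h.ne_zero)
      (Finset.prod_ne_zero_iff.2 fun i _ => pow_ne_zero _ (hf0 i))
  have hb : b ≠ 0 := fun hb => hF0 (by rw [hF, hb, zero_smul])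
  have hass : Associated (∏ i, y i ^ k i) (∏ i, fs i ^ k i) := by
    refine (associated_smul hb _).trans ?_
    rw [← hF, h.eq_mul_prod, ← smul_eq_C_mul]
    exact (associated_smul h.ne_zero _).symm
  have hydeg : ∀ i t, (y i).degreeOf t = mdeg i t := fun i t => by
    have := degreeOf_eq_of_associated hass t
    rw [degreeOf_prod_pow _ hy0, degreeOf_prod_pow _ hf0] at this
    simp only [h.degreeOf_eq] at this
    exact Nat.eq_of_mul_eq_mul_left (hk i) <| (Finset.sum_eq_sum_iff_of_le fun i _ =>
      Nat.mul_le_mul_left (k i) (mem_box_iff.1 (hy i) t)).1 this i (Finset.mem_univ i)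
  have hyu : ∀ i, ¬ IsUnit (y i) := fun i hu => hmdeg i <| funext fun t => by
    obtain ⟨c, -, hc⟩ := isUnit_iff_eq_C_of_isReduced.1 hu
    rw [← hydeg i t, hc, degreeOf_C, Pi.zero_apply]
  obtain ⟨σ, hσ⟩ :=
    exists_perm_associated_of_prod_pow hk h.irreducible h.not_associated hyu hass
  refine ⟨σ, fun i => funext fun t => ?_, fun i => (hσ i).2, fun i => (hσ i).1⟩
  rw [← hydeg, degreeOf_eq_of_associated (hσ i).1, h.degreeOf_eq]

/-- Every sequence on the factorization manifold converging to `F` has a subsequence along which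
suitable irreducible factorizations converge, with prescribed coefficients at `d i`. -/
theorem IsFactorization.exists_subseq_tendsto {r : ℕ} {mdeg : Fin r → Fin ℓ → ℕ} {k : Fin r → ℕ}
    {F : MvPolynomial (Fin ℓ) ℂ} {α : ℂ} {f : (i : Fin r) → box (mdeg i)}
    (h : IsFactorization mdeg k F α fun i => f i) (hmdeg : ∀ i, mdeg i ≠ 0) (hk : ∀ i, 1 ≤ k i)
    {d : Fin r → Fin ℓ →₀ ℕ} (hd : ∀ i, (f i : MvPolynomial (Fin ℓ) ℂ).coeff (d i) ≠ 0)
    {g : ℕ → MvPolynomial (Fin ℓ) ℂ} (hg : ∀ n, ∃ β gs, IsFactorization mdeg k (g n) β gs)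
    (hgF : Tendsto g atTop (𝓝 F)) :
    ∃ (φ : ℕ → ℕ) (x : ℕ → ℂ × ((i : Fin r) → box (mdeg i))), StrictMono φ ∧
      Tendsto x atTop (𝓝 (α, f)) ∧ ∀ᶠ n in atTop,
        IsFactorization mdeg k (g (φ n)) (x n).1 (fun i => (x n).2 i) ∧
        ∀ i, ((x n).2 i : MvPolynomial (Fin ℓ) ℂ).coeff (d i)
          = (f i : MvPolynomial (Fin ℓ) ℂ).coeff (d i) := by
  have hf0 : ∀ i, (f i : MvPolynomial (Fin ℓ) ℂ) ≠ 0 := fun i => (h.irreducible i).ne_zero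
  have hnorm : ∀ n, ∃ β gs, IsFactorization mdeg k (g n) β gs ∧ ∀ i, ‖gs i‖ = 1 := fun n => by
    obtain ⟨β, gs, h⟩ := hg n
    exact h.exists_norm_eq_one
  choose β gs hfac hone using hnorm
  let y (n : ℕ) (i : Fin r) : box (mdeg i) :=
    ⟨gs n i, mem_box_iff.2 fun t => ((hfac n).degreeOf_eq i t).le⟩
  have : ProperSpace ((i : Fin r) → box (mdeg i)) := FiniteDimensional.proper ℂ _
  obtain ⟨ylim, -, φ, hφ, hylim⟩ := (isCompact_closedBall
    (0 : (i : Fin r) → box (mdeg i)) 1).tendsto_subseq (x := y) fun n => by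
      rw [mem_closedBall_zero_iff, pi_norm_le_iff_of_nonneg zero_le_one]
      exact fun i => (hone n i).le
  have hylim' : ∀ i, Tendsto (fun n => gs (φ n) i) atTop
      (𝓝 (ylim i : MvPolynomial (Fin ℓ) ℂ)) := fun i =>
    (continuous_subtype_val.tendsto _).comp (tendsto_pi_nhds.1 hylim i)
  have hylim0 : ∀ i, (ylim i : MvPolynomial (Fin ℓ) ℂ) ≠ 0 := fun i hi => by
    have h1 := tendsto_nhds_unique (hylim' i).norm
      (tendsto_const_nhds.congr fun n => (hone (φ n) i).symm)
    rw [hi, norm_zero] at h1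
    exact zero_ne_one h1
  have hgφ : Tendsto (fun n => g (φ n)) atTop (𝓝 F) := hgF.comp hφ.tendsto_atTop
  obtain ⟨b, -, hb⟩ := exists_tendsto_of_tendsto_smul (b := fun n => β (φ n))
    (tendsto_finsetProd Finset.univ fun i _ => (hylim' i).pow (k i))
    (Finset.prod_ne_zero_iff.2 fun i _ => pow_ne_zero _ (hylim0 i))
    (hgφ.congr fun n => by rw [(hfac (φ n)).eq_mul_prod, smul_eq_C_mul])
  obtain ⟨σ, hσm, hσk, hσ⟩ := h.exists_perm hmdeg hk (fun i => (ylim i).2) hylim0 hb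
  choose c hc0 hc using fun i => exists_smul_eq_of_associated (hσ i)
  let s (n : ℕ) (i : Fin r) : ℂ :=
    (f i : MvPolynomial (Fin ℓ) ℂ).coeff (d i) / (gs (φ n) (σ i)).coeff (d i)
  have hcoeff : ∀ i, Tendsto (fun n => (gs (φ n) (σ i)).coeff (d i)) atTop
      (𝓝 ((ylim (σ i) : MvPolynomial (Fin ℓ) ℂ).coeff (d i))) := fun i =>
    ((coeffCLM (d i)).continuous.tendsto _).comp (hylim' (σ i))
  have hcd : ∀ i, (f i : MvPolynomial (Fin ℓ) ℂ).coeff (d i)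
      = c i * (ylim (σ i) : MvPolynomial (Fin ℓ) ℂ).coeff (d i) := fun i => by
    rw [hc i, coeff_smul, smul_eq_mul]
  have hyd : ∀ i, (ylim (σ i) : MvPolynomial (Fin ℓ) ℂ).coeff (d i) ≠ 0 := fun i hi =>
    hd i (by rw [hcd, hi, mul_zero])
  have hs : ∀ i, Tendsto (fun n => s n i) atTop (𝓝 (c i)) := fun i => by
    have := (tendsto_const_nhds (x := (f i : MvPolynomial (Fin ℓ) ℂ).coeff (d i))).div
      (hcoeff i) (hyd i)
    rwa [hcd, mul_div_cancel_right₀ _ (hyd i), ← hcd] at this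
  let z (n : ℕ) (i : Fin r) : box (mdeg i) := ⟨s n i • gs (φ n) (σ i), (box (mdeg i)).smul_mem _ <|
    mem_box_iff.2 fun t => by rw [(hfac (φ n)).degreeOf_eq, hσm]⟩
  have hz' : ∀ i, Tendsto (fun n => (z n i : MvPolynomial (Fin ℓ) ℂ)) atTop
      (𝓝 (f i : MvPolynomial (Fin ℓ) ℂ)) := fun i => by
    rw [hc i]
    exact (hs i).smul (hylim' (σ i))
  have hz : Tendsto z atTop (𝓝 f) := tendsto_pi_nhds.2 fun i => tendsto_subtype_rng.2 (hz' i)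
  let β' (n : ℕ) : ℂ := β (φ n) * ∏ i, (s n i ^ k i)⁻¹
  have hev : ∀ᶠ n in atTop, IsFactorization mdeg k (g (φ n)) (β' n) (fun i => z n i) ∧
      ∀ i, (z n i : MvPolynomial (Fin ℓ) ℂ).coeff (d i)
        = (f i : MvPolynomial (Fin ℓ) ℂ).coeff (d i) := by
    filter_upwards [eventually_all.2 fun i => (hcoeff i).eventually_ne (hyd i)] with n hn
    exact ⟨((hfac (φ n)).perm hσm hσk).smul fun i => div_ne_zero (hd i) (hn i),
      fun i => by simp [z, s, hn i]⟩
  have hP0 : ∏ i, (f i : MvPolynomial (Fin ℓ) ℂ) ^ k i ≠ 0 :=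
    Finset.prod_ne_zero_iff.2 fun i _ => pow_ne_zero _ (hf0 i)
  obtain ⟨a, ha, haF⟩ := exists_tendsto_of_tendsto_smul (b := β')
    (tendsto_finsetProd Finset.univ fun i _ => (hz' i).pow (k i)) hP0
    (hgφ.congr' <| by
      filter_upwards [hev] with n hn
      rw [hn.1.eq_mul_prod, smul_eq_C_mul])
  have haα : a = α := smul_left_injective ℂ hP0 <| by
    simp only [← haF, smul_eq_C_mul, ← h.eq_mul_prod]
  exact ⟨φ, fun n => (β' n, z n), hφ, (haα ▸ ha).prodMk_nhds hz, hev⟩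

theorem IsFactorization.exists_psin_le {r : ℕ} {m : Fin ℓ → ℕ} {mdeg : Fin r → Fin ℓ → ℕ}
    {k : Fin r → ℕ} {F : MvPolynomial (Fin ℓ) ℂ} {α : ℂ} {fs : Fin r → MvPolynomial (Fin ℓ) ℂ}
    (h : IsFactorization mdeg k F α fs) (hmdeg : ∀ i, mdeg i ≠ 0) (hk : ∀ i, 1 ≤ k i)
    (hsum : ∀ t, ∑ i, k i * mdeg i t = m t) (hnorm : ∀ i, pNorm (fs i) = 1) :
    ∃ δ η : ℝ, 0 < δ ∧ 0 < η ∧ ∀ g, (∃ β gs, IsFactorization mdeg k g β gs) →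
      pNorm (F - g) < δ → ∃ β gs, IsFactorization mdeg k g β gs ∧
        ∀ i, psin (fs i) (gs i) ≤ η * pNorm (F - g) := by
  by_contra! hcon
  choose g hg hgδ hgη using fun n : ℕ => hcon (1 / ((n : ℝ) + 1)) (n + 1) (by positivity)
    (by positivity)
  let f (i : Fin r) : box (mdeg i) := ⟨fs i, mem_box_iff.2 fun t => (h.degreeOf_eq i t).le⟩
  choose d hd using fun i => ne_zero_iff.1 (h.irreducible i).ne_zero
  set N : ℝ := √(boxExponents m).card
  have hbound : ∀ n, ‖g n - F‖ ≤ N * pNorm (F - g n) := fun n => by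
    rw [norm_sub_rev]
    obtain ⟨β, gs, hgs⟩ := hg n
    exact coeffSum_le_sqrt_card_mul_pNorm <| Finset.coe_subset.1 <|
      (mem_restrictSupport_iff ℂ).1 <| (box m).sub_mem (h.mem_box hsum) (hgs.mem_box hsum)
  have hgF : Tendsto g atTop (𝓝 F) := by
    refine tendsto_iff_norm_sub_tendsto_zero.2 <| squeeze_zero (fun n => norm_nonneg _)
      (fun n => (hbound n).trans (mul_le_mul_of_nonneg_left (hgδ n).le (Real.sqrt_nonneg _))) ?_
    simpa using tendsto_one_div_add_atTop_nhds_zero_nat.const_mul N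
  obtain ⟨φ, x, hφ, hx, hfac⟩ :=
    IsFactorization.exists_subseq_tendsto (f := f) h hmdeg hk hd hg hgF
  obtain ⟨K, hK⟩ := exists_eventually_norm_sub_le_factorizationMap (f := f) hk h.ne_zero
    h.irreducible h.not_associated h.degreeOf_eq hd
  have hlarge : ∀ᶠ n in atTop, |K| * N ≤ ((φ n : ℕ) : ℝ) + 1 :=
    (tendsto_atTop_add_const_right _ _ (tendsto_natCast_atTop_atTop.comp
      hφ.tendsto_atTop)).eventually_ge_atTop _
  obtain ⟨n, ⟨hn, hnd⟩, hnK, hnl⟩ := (hfac.and ((hx.eventually hK).and hlarge)).exists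
  obtain ⟨i, hi⟩ := hgη (φ n) _ _ hn
  refine hi.not_ge ?_
  have hmap : factorizationMap mdeg k d (x n) - factorizationMap mdeg k d (α, f)
      = (g (φ n) - F, 0) := by
    refine Prod.ext ?_ (funext fun i => ?_)
    · simp only [factorizationMap, Prod.fst_sub, smul_eq_C_mul]
      rw [hn.eq_mul_prod, h.eq_mul_prod]
    · simp [factorizationMap, hnd i]
  have hmapnorm : ‖((g (φ n) - F, 0) : MvPolynomial (Fin ℓ) ℂ × (Fin r → ℂ))‖
      = ‖g (φ n) - F‖ := by simp [Prod.norm_def]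
  rw [hmap, hmapnorm] at hnK
  calc psin (fs i) ((x n).2 i)
      ≤ pNorm (fs i - ((x n).2 i : MvPolynomial (Fin ℓ) ℂ)) :=
        psin_le_pNorm_sub (hnorm i) (h.irreducible i).ne_zero (hn.irreducible i).ne_zero
    _ ≤ ‖fs i - ((x n).2 i : MvPolynomial (Fin ℓ) ℂ)‖ := pNorm_le_coeffSum _
    _ = ‖(x n).2 i - f i‖ := norm_sub_rev _ _
    _ ≤ ‖(x n).2 - f‖ := norm_le_pi_norm ((x n).2 - f) i
    _ ≤ ‖x n - (α, f)‖ := norm_snd_le (x n - (α, f))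
    _ ≤ K * ‖g (φ n) - F‖ := hnK
    _ ≤ |K| * (N * pNorm (F - g (φ n))) := by
      gcongr
      exacts [le_abs_self K, hbound _]
    _ ≤ (φ n + 1) * pNorm (F - g (φ n)) := by
      rw [← mul_assoc]
      exact mul_le_mul_of_nonneg_right hnl (Real.sqrt_nonneg _)

end Factorization

/-- Factorization Continuity Theorem: irreducible factorization is locally Lipschitz
continuous on the factorization manifold `F^𝔐`. -/
theorem factorization_locally_lipschitz (ℓ : ℕ) (hl : 1 ≤ ℓ) (m : Fin ℓ → ℕ) (hm : m ≠ 0)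
    (r : ℕ) (hr : 1 ≤ r) (mdeg : Fin r → Fin ℓ → ℕ) (k : Fin r → ℕ)
    (hmdeg : ∀ i, mdeg i ≠ 0) (hk : ∀ i, 1 ≤ k i)
    (hsum : ∀ t, ∑ i, k i * mdeg i t = m t)
    (F : MvPolynomial (Fin ℓ) ℂ) (α : ℂ) (fs : Fin r → MvPolynomial (Fin ℓ) ℂ)
    (hα : α ≠ 0) (hirr : ∀ i, Irreducible (fs i))
    (hdeg : ∀ i t, (fs i).degreeOf t = mdeg i t)
    (hassoc : ∀ i j : Fin r, i ≠ j → ¬ Associated (fs i) (fs j))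
    (hnorm : ∀ i, pNorm (fs i) = 1)
    (hF : F = MvPolynomial.C α * ∏ i, fs i ^ k i) :
    ∃ δ η : ℝ, 0 < δ ∧ 0 < η ∧
      ∀ g ∈ FMset r mdeg k, pNorm (F - g) < δ →
        ∃ (β : ℂ) (gs : Fin r → MvPolynomial (Fin ℓ) ℂ),
          β ≠ 0 ∧ (∀ i, Irreducible (gs i)) ∧
          (∀ i t, (gs i).degreeOf t = mdeg i t) ∧
          (∀ i j : Fin r, i ≠ j → ¬ Associated (gs i) (gs j)) ∧
          g = MvPolynomial.C β * ∏ i, gs i ^ k i ∧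
          (Finset.univ : Finset (Fin r)).sup' ⟨⟨0, hr⟩, Finset.mem_univ _⟩
              (fun i => psin (fs i) (gs i)) ≤ η * pNorm (F - g) := by
  have h : IsFactorization mdeg k F α fs := ⟨hα, hirr, hdeg, hassoc, hF⟩
  obtain ⟨δ, η, hδ, hη, hlip⟩ := h.exists_psin_le hmdeg hk hsum hnorm
  refine ⟨δ, η, hδ, hη, fun g hg hgδ => ?_⟩
  obtain ⟨β, gs, hβ, hgirr, hgdeg, hgassoc, hgeq⟩ := hg
  obtain ⟨β', gs', hfac, hle⟩ := hlip g ⟨β, gs, hβ, hgirr, hgdeg, hgassoc, hgeq⟩ hgδ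
  exact ⟨β', gs', hfac.ne_zero, hfac.irreducible, hfac.degreeOf_eq, hfac.not_associated,
    hfac.eq_mul_prod, Finset.sup'_le _ _ fun i _ => hle i⟩
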